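/- arXiv:math/0307076 — 2 statements merged into one kernel-verified Lean document; each statement's English description precedes it below -/
import Mathlib

section
/- Let K|k be a function field over a field k, and let v be a nontrivial valuation of K which is trivial on k and whose residue field Kv satisfies td(Kv|k) = td(K|k) − 1. Then the value group vK is isomorphic to ℤ (i.e., v is a discrete rank-one valuation), and Kv|k is again a finitely generated field extension. -/
open IntermediateField

/-- Transcendence degree of a ring extension. -/
noncomputable def trdeg (k K : Type*) [CommRing k] [CommRing K] [Algebra k K] : Cardinal :=
  ⨆ s : {s : Set K // AlgebraicIndependent k ((↑) : s → K)}, Cardinal.mk s.1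

/-- The canonical map from the base field to the residue field of a valuation subring whose
ring contains the base field. -/
noncomputable def resMap {k K : Type*} [Field k] [Field K] [Algebra k K]
    (O : ValuationSubring K) (h : ∀ c : k, algebraMap k K c ∈ O) :
    k →+* IsLocalRing.ResidueField ↥O :=
  (IsLocalRing.residue ↥O).comp ((algebraMap k K).codRestrict O.toSubring h)

open scoped IntermediateField.algebraAdjoinAdjoin in
lemma aux_finite_quot (F K O : Type*) [Field F] [Field K] [Algebra F K] [CommRing O] [IsDomain O]
    [IsIntegrallyClosed O]
    [Algebra O K] [IsFractionRing O K] [Algebra F O] [IsScalarTower F O K]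
    [Algebra.EssFiniteType F K] (htr : Algebra.trdeg F K = 1) (t : O) (ht0 : t ≠ 0)
    (htu : ¬ IsUnit t) : Module.Finite F (O ⧸ Ideal.span {t}) := by
  have hinj : Function.Injective (algebraMap O K) := IsFractionRing.injective O K
  set s : K := algebraMap O K t with hs
  have hs0 : s ≠ 0 := by
    intro h; exact ht0 (hinj (by rw [← hs, h, map_zero]))
  have htrans : Transcendental F s := by
    intro halg
    have h1 : IsIntegral O s⁻¹ := (isAlgebraic_iff_isIntegral.1 halg.inv).tower_top
    obtain ⟨u, hu⟩ := IsIntegrallyClosed.isIntegral_iff.1 h1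
    apply htu
    refine IsUnit.of_mul_eq_one u (hinj ?_)
    rw [map_mul, hu, map_one, ← hs, mul_inv_cancel₀ hs0]
  have hbasis : IsTranscendenceBasis F (fun _ : Fin 1 => s) := by
    apply AlgebraicIndependent.isTranscendenceBasis_of_lift_trdeg_le_of_finite
    · exact (algebraicIndependent_unique_type_iff (ι := Fin 1)).2 htrans
    · simp [htr]
  have hrange : Set.range (fun _ : Fin 1 => s) = {s} := by simp
  obtain ⟨S, hS⟩ : ∃ S : Set K, S = {s} := ⟨_, rfl⟩
  rw [← hS] at hrange
  have halg : Algebra.IsAlgebraic (adjoin F S) K := by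
    have := hbasis.isAlgebraic_field
    rwa [hrange] at this
  have : Algebra.EssFiniteType (adjoin F S) K := .of_comp F _ K
  have : Module.Finite (adjoin F S) K := Algebra.finite_of_essFiniteType_of_isAlgebraic
  let b := Module.Basis.ofVectorSpace F (O ⧸ Ideal.span {t})
  have hsurj := Ideal.Quotient.mk_surjective (I := Ideal.span {t})
  choose u hu using fun i => hsurj (b i)
  -- key induction
  have key : ∀ (J : Finset _) (n : ℕ) (p : _ → Polynomial F),
      ∑ i ∈ J, Polynomial.aeval t (p i) * u i = 0 → ∀ i ∈ J, Polynomial.X ^ n ∣ p i := by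
    intro J n
    induction n with
    | zero => intro p _ i _; simp
    | succ n ih =>
      intro p hp
      have h0 : ∀ i ∈ J, (p i).coeff 0 = 0 := by
        have h1 : ∑ i ∈ J, (p i).coeff 0 • b i = 0 := by
          have h2 := congrArg (Ideal.Quotient.mk (Ideal.span {t})) hp
          rw [map_sum, map_zero] at h2
          rw [← h2]
          refine Finset.sum_congr rfl fun i _ => ?_
          rw [map_mul, hu, Algebra.smul_def]
          congr 1
          rw [IsScalarTower.algebraMap_apply F O (O ⧸ Ideal.span {t})]
          change Ideal.Quotient.mk _ _ = _
          rw [Ideal.Quotient.mk_eq_mk_iff_sub_mem, Ideal.mem_span_singleton]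
          have := Polynomial.divX_mul_X_add (p i)
          conv_rhs => rw [← this]
          simp
        exact linearIndependent_iff'.1 b.linearIndependent J _ h1
      have hq : ∀ i ∈ J, p i = Polynomial.X * (p i).divX := by
        intro i hi
        conv_lhs => rw [← Polynomial.divX_mul_X_add (p i), h0 i hi]
        simp [mul_comm]
      have hsum : ∑ i ∈ J, Polynomial.aeval t (p i).divX * u i = 0 := by
        have : t * ∑ i ∈ J, Polynomial.aeval t (p i).divX * u i = 0 := by
          rw [← hp, Finset.mul_sum]
          refine Finset.sum_congr rfl fun i hi => ?_
          conv_rhs => rw [hq i hi]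
          simp [mul_assoc]
        exact (mul_eq_zero.1 this).resolve_left ht0
      intro i hi
      rw [hq i hi, pow_succ']
      exact mul_dvd_mul_left _ (ih _ hsum i hi)
  have hli : LinearIndependent (Algebra.adjoin F S) (fun i => algebraMap O K (u i)) := by
    rw [linearIndependent_iff']
    intro J g hg i hi
    have hex : ∀ i, ∃ p : Polynomial F, Polynomial.aeval s p = (g i : K) := by
      intro i
      have h3 : ∀ x ∈ Algebra.adjoin F S, ∃ p : Polynomial F, Polynomial.aeval s p = x := by
        intro x hx
        rw [hS, Algebra.adjoin_singleton_eq_range_aeval] at hx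
        exact hx
      exact h3 _ (g i).2
    choose p hp using hex
    have hz : ∑ i ∈ J, Polynomial.aeval t (p i) * u i = 0 := by
      apply hinj
      rw [map_zero, ← hg, map_sum]
      refine Finset.sum_congr rfl fun i _ => ?_
      rw [map_mul, Algebra.smul_def, ← Polynomial.aeval_algebraMap_apply, ← hs, hp]
      rfl
    have hp0 : p i = 0 := by
      by_contra hne
      have := Polynomial.natDegree_le_of_dvd (key J ((p i).natDegree + 1) p hz i hi) hne
      simp at this
    apply Subtype.ext
    rw [← hp, hp0]; simp
  rw [LinearIndependent.iff_fractionRing (Algebra.adjoin F S) (adjoin F S)] at hli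
  have := hli.finite
  exact Module.Finite.of_basis b

lemma aux_noeth (F K O : Type*) [Field F] [Field K] [Algebra F K] [CommRing O] [IsDomain O]
    [ValuationRing O]
    [Algebra O K] [IsFractionRing O K] [Algebra F O] [IsScalarTower F O K]
    [Algebra.EssFiniteType F K] (htr : Algebra.trdeg F K = 1) : IsNoetherianRing O := by
  refine ⟨fun I => ?_⟩
  by_cases hI : I = ⊥
  · subst hI; exact Submodule.fg_bot
  obtain ⟨t, htI, ht0⟩ := Submodule.exists_mem_ne_zero_of_ne_bot hI
  by_cases htu : IsUnit t
  · rw [Ideal.eq_top_of_isUnit_mem I htI htu]; exact ⟨{1}, by simp⟩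
  have := aux_finite_quot F K O htr t ht0 htu
  have hN' : IsNoetherian O (O ⧸ Ideal.span {t}) :=
    isNoetherian_of_tower F inferInstance
  refine Submodule.fg_of_fg_map_of_fg_inf_ker (Submodule.mkQ (Ideal.span {t})) ?_ ?_
  · exact IsNoetherian.noetherian _
  · rw [Submodule.ker_mkQ, inf_eq_right.2]
    · exact ⟨{t}, by simp⟩
    · rwa [Ideal.span_singleton_le_iff_mem]


lemma aux_val (K : Type*) [Field K] (O : ValuationSubring K) [IsDiscreteValuationRing O] :
    Nonempty ((O.ValueGroup)ˣ ≃* Multiplicative ℤ) := by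
  obtain ⟨ϖ, hϖ⟩ := IsDiscreteValuationRing.exists_irreducible O
  have hK0 : (ϖ : K) ≠ 0 := fun h => hϖ.ne_zero (Subtype.ext h)
  have hlt : O.valuation ϖ < 1 :=
    (O.valuation_lt_one_iff ϖ).1 ((IsLocalRing.mem_maximalIdeal _).2 hϖ.1)
  have hv0 : O.valuation ϖ ≠ 0 := (Valuation.ne_zero_iff _).2 hK0
  let g : (O.ValueGroup)ˣ := Units.mk0 _ hv0
  have hg1 : g < 1 := by rw [← Units.val_lt_val]; exact hlt
  let f : Multiplicative ℤ →* (O.ValueGroup)ˣ := zpowersHom _ g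
  have hinj : Function.Injective f := by
    rw [injective_iff_map_eq_one]
    intro a ha
    have h : g ^ (a.toAdd) = 1 := ha
    have : a.toAdd = 0 := (zpow_right_strictAnti hg1).injective (h.trans (zpow_zero g).symm)
    exact this
  have hO : ∀ x : O, x ≠ 0 → ∃ n : ℕ, O.valuation x = (g : O.ValueGroup) ^ n := by
    intro x hx
    obtain ⟨n, u, rfl⟩ := IsDiscreteValuationRing.eq_unit_mul_pow_irreducible hx hϖ
    refine ⟨n, ?_⟩
    have := O.valuation_unit u
    simp [g, this]
  have hsurj : Function.Surjective f := by
    intro y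
    obtain ⟨x, hx⟩ := O.valuation_surjective y
    have hx0 : x ≠ 0 := by
      rintro rfl
      exact y.ne_zero (by rw [← hx, map_zero])
    rcases O.mem_or_inv_mem x with h | h
    · obtain ⟨n, hn⟩ := hO ⟨x, h⟩ (fun h => hx0 (congrArg Subtype.val h))
      refine ⟨Multiplicative.ofAdd (n : ℤ), Units.ext ?_⟩
      rw [← hx]
      simpa [f] using hn.symm
    · obtain ⟨n, hn⟩ := hO ⟨x⁻¹, h⟩ (fun h => inv_ne_zero hx0 (congrArg Subtype.val h))
      refine ⟨Multiplicative.ofAdd (-n : ℤ), Units.ext ?_⟩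
      rw [← hx]
      simp only [map_inv₀] at hn
      simp [f, ← hn]
  exact ⟨(MulEquiv.ofBijective f ⟨hinj, hsurj⟩).symm⟩

universe uk uK in
open scoped IntermediateField.algebraAdjoinAdjoin in
lemma aux_trdeg_adjoin (k : Type uk) (K : Type uK) [Field k] [Field K] [Algebra k K] {ι : Type uK}
    (x : ι → K) (hx : AlgebraicIndependent k x) :
    Algebra.trdeg k (IntermediateField.adjoin k (Set.range x)) = Cardinal.mk ι := by
  have h1 := trdeg_add_eq k (Algebra.adjoin k (Set.range x))
    (A := IntermediateField.adjoin k (Set.range x))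
  rw [(trdeg_eq_zero_iff (R := Algebra.adjoin k (Set.range x))).2 inferInstance, add_zero] at h1
  rw [← h1]
  have h2 := hx.aevalEquiv.lift_trdeg_eq
  rw [MvPolynomial.trdeg_of_isDomain] at h2
  simpa using h2.symm

/-- Let `K|k` be a function field and `v` a nontrivial valuation of `K`,
trivial on `k`, with `td(Kv|k) = td(K|k) - 1`. Then the value group of `v` is isomorphic to
`ℤ`, and `Kv|k` is a finitely generated field extension. -/
theorem statement10 (k K : Type*) [Field k] [Field K] [Algebra k K]
    (hKfg : (⊤ : IntermediateField k K).FG)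
    (O : ValuationSubring K) (hnt : O ≠ ⊤)
    (htriv : ∀ c : k, algebraMap k K c ∈ O)
    (hres : (letI := (resMap O htriv).toAlgebra;
      trdeg k (IsLocalRing.ResidueField ↥O) + 1 = trdeg k K)) :
    Nonempty ((O.ValueGroup)ˣ ≃* Multiplicative ℤ) ∧
      (letI := (resMap O htriv).toAlgebra;
        (⊤ : IntermediateField k (IsLocalRing.ResidueField ↥O)).FG) := by
  classical
  let algO : Algebra k O := ((algebraMap k K).codRestrict O.toSubring htriv).toAlgebra
  have tow1 : IsScalarTower k O K := IsScalarTower.of_algebraMap_eq fun _ => rfl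
  let algR : Algebra k (IsLocalRing.ResidueField O) := (resMap O htriv).toAlgebra
  change Algebra.trdeg k (IsLocalRing.ResidueField O) + 1 = Algebra.trdeg k K at hres
  have hKe : Algebra.EssFiniteType k K := IntermediateField.fg_top_iff.1 hKfg
  have hfin : Algebra.trdeg k K < Cardinal.aleph0 := trdeg_lt_aleph0 k K
  let res : O →ₐ[k] IsLocalRing.ResidueField O :=
    { IsLocalRing.residue O with commutes' := fun _ => rfl }
  have hresS : Function.Surjective res := IsLocalRing.residue_surjective
  obtain ⟨s, hs⟩ := exists_isTranscendenceBasis k (IsLocalRing.ResidueField O)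
  have hscard := hs.cardinalMk_eq_trdeg
  have hsfin : Algebra.trdeg k (IsLocalRing.ResidueField O) < Cardinal.aleph0 :=
    lt_of_le_of_lt (by rw [← hres]; exact self_le_add_right _ _) hfin
  have hsF : Finite s := by
    rw [← Cardinal.mk_lt_aleph0_iff, hscard]; exact hsfin
  choose y hy using fun i : s => hresS i.1
  have hindR : AlgebraicIndependent k (fun i : s => res (y i)) := by
    simpa only [hy] using hs.1
  have hindO : AlgebraicIndependent k y := AlgebraicIndependent.of_comp res hindR
  have hind : AlgebraicIndependent k (fun i : s => (y i : K)) :=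
    hindO.map' (f := IsScalarTower.toAlgHom k O K) (IsFractionRing.injective O K)
  let S : Set K := Set.range (fun i : s => (y i : K))
  let k' : IntermediateField k K := IntermediateField.adjoin k S
  have hrep : ∀ a ∈ Algebra.adjoin k S, ∃ p : MvPolynomial s k,
      a = (MvPolynomial.aeval y p : O) := by
    intro a ha
    rw [Algebra.adjoin_range_eq_range_aeval] at ha
    obtain ⟨p, rfl⟩ := ha
    refine ⟨p, ?_⟩
    exact MvPolynomial.aeval_algebraMap_apply (B := K) y p
  have hk' : ∀ x : k', (x : K) ∈ O := by
    rintro ⟨x, hx⟩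
    obtain ⟨a, ha, b, hb, rfl⟩ := IntermediateField.mem_adjoin_iff_div.1 hx
    obtain ⟨p, rfl⟩ := hrep a ha
    obtain ⟨q, rfl⟩ := hrep b hb
    by_cases hq : q = 0
    · subst hq; simp [O.zero_mem]
    have hne : res (MvPolynomial.aeval y q) ≠ 0 := by
      intro h0
      rw [MvPolynomial.comp_aeval_apply] at h0
      exact hq (hindR.eq_zero_of_aeval_eq_zero q h0)
    have hu : IsUnit (MvPolynomial.aeval y q : O) :=
      (IsLocalRing.residue_ne_zero_iff_isUnit _).1 hne
    obtain ⟨u, hu⟩ := hu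
    have hinv : (((MvPolynomial.aeval y q : O) : K))⁻¹ = ((u⁻¹ : Oˣ) : O) := by
      rw [← hu]
      refine inv_eq_of_mul_eq_one_right ?_
      exact congrArg Subtype.val u.mul_inv
    change (((MvPolynomial.aeval y p : O) : K)) / ((MvPolynomial.aeval y q : O) : K) ∈ O
    rw [div_eq_mul_inv]
    change _ * (((MvPolynomial.aeval y q : O) : K))⁻¹ ∈ O
    rw [hinv]
    exact O.mul_mem _ _ (Subtype.prop _) (Subtype.prop _)
  let algO' : Algebra k' O := ((algebraMap k' K).codRestrict O.toSubring hk').toAlgebra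
  have tow2 : IsScalarTower k' O K := IsScalarTower.of_algebraMap_eq fun _ => rfl
  have tow3 : IsScalarTower k k' (IsLocalRing.ResidueField O) :=
    IsScalarTower.of_algebraMap_eq fun _ => rfl
  have hK'e : Algebra.EssFiniteType k' K := .of_comp k k' K
  have hk'e : Algebra.EssFiniteType k k' :=
    IntermediateField.essFiniteType_iff.2
      (IntermediateField.fg_adjoin_of_finite (Set.finite_range _))
  have htr' : Algebra.trdeg k k' = Algebra.trdeg k (IsLocalRing.ResidueField O) := by
    rw [← hscard]
    exact aux_trdeg_adjoin k K _ hind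
  have htr : Algebra.trdeg k' K = 1 := by
    have h1 := trdeg_add_eq k k' (A := K)
    rw [htr', ← hres] at h1
    exact Cardinal.eq_of_add_eq_add_left h1 hsfin
  have hN : IsNoetherianRing O := aux_noeth k' K O htr
  have hnf : ¬ IsField O := by
    intro hF
    apply hnt
    rw [eq_top_iff]
    intro x _
    obtain ⟨z, hz⟩ := (IsFractionRing.surjective_iff_isField (R := O) (K := K)).2 hF x
    rw [← hz]; exact z.2
  have hdvr : IsDiscreteValuationRing O :=
    ((IsDiscreteValuationRing.TFAE O hnf).out 0 1 :
      IsDiscreteValuationRing O ↔ ValuationRing O).2 inferInstance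
  refine ⟨aux_val K O, ?_⟩
  change (⊤ : IntermediateField k (IsLocalRing.ResidueField O)).FG
  rw [IntermediateField.fg_top_iff]
  have hfinR : Module.Finite k' (IsLocalRing.ResidueField O) := by
    obtain ⟨ϖ, hϖ⟩ := IsDiscreteValuationRing.exists_irreducible O
    have h1 := aux_finite_quot k' K O htr ϖ hϖ.ne_zero hϖ.1
    have hle : Ideal.span {ϖ} ≤ IsLocalRing.maximalIdeal O := by
      rw [Ideal.span_singleton_le_iff_mem]
      exact (IsLocalRing.mem_maximalIdeal _).2 hϖ.1
    exact Module.Finite.of_surjective (Ideal.Quotient.factorₐ k' hle).toLinearMap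
      (Ideal.Quotient.factor_surjective hle)
  exact .comp k k' _
end

section
/- Let K|k be a function field over an algebraically closed field k, and let x, y ∈ K be algebraically independent over k. Then there exists a Zariski prime divisor v of K|k such that v(x) > 0 and v(y) = 0. -/
open IntermediateField

/-- A Zariski prime divisor of `K|k`, given by its valuation ring `O`: a nontrivial valuation
of `K`, trivial on `k`, with value group isomorphic to `ℤ`, whose residue field `Kv` satisfies
`td(Kv|k) = td(K|k) - 1`. -/
structure IsZPD (k : Type*) [Field k] {K : Type*} [Field K] [Algebra k K]
    (O : ValuationSubring K) : Prop where
  trivialBase : ∀ c : k, algebraMap k K c ∈ O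
  nontrivial : O ≠ ⊤
  discrete : Nonempty ((O.ValueGroup)ˣ ≃* Multiplicative ℤ)
  residue_td :
    letI := (resMap O trivialBase).toAlgebra
    trdeg k (IsLocalRing.ResidueField ↥O) + 1 = trdeg k K


theorem aux_val_aeval {C K Γ : Type*} [CommRing C] [Field K] [Algebra C K]
    [LinearOrderedCommGroupWithZero Γ] (v : Valuation K Γ)
    (h : ∀ c : C, c ≠ 0 → v (algebraMap C K c) = 1) (x : K) (hx : v x < 1)
    (p : Polynomial C) :
    v (Polynomial.aeval x p) ≤ 1 ∧ (p.coeff 0 = 0 → v (Polynomial.aeval x p) < 1) ∧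
      (p ≠ 0 → ∃ m : ℕ, v (Polynomial.aeval x p) = v x ^ m) := by
  induction p using Polynomial.recOnHorner with
  | M0 => simp
  | MC p a hp ha ih =>
    have h1 : v (Polynomial.aeval x (p + Polynomial.C a)) = 1 := by
      rw [map_add, Polynomial.aeval_C, Valuation.map_add_eq_of_lt_right, h a ha]
      rw [h a ha]; exact ih.2.1 hp
    refine ⟨h1.le, ?_, fun _ => ⟨0, by rw [h1, pow_zero]⟩⟩
    intro h0
    simp [hp] at h0
    exact absurd h0 ha
  | MX p hp ih =>
    obtain ⟨h1, h2, h3⟩ := ih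
    have h4 : v (Polynomial.aeval x (p * Polynomial.X)) < 1 := by
      rw [map_mul, Polynomial.aeval_X, map_mul]
      exact lt_of_le_of_lt (mul_le_of_le_one_left' h1) hx
    refine ⟨h4.le, fun _ => h4, fun _ => ?_⟩
    obtain ⟨m, hm⟩ := h3 hp
    exact ⟨m + 1, by simp [hm, pow_succ]⟩

theorem aux_transc {C K Γ : Type*} [CommRing C] [Field K] [Algebra C K]
    [LinearOrderedCommGroupWithZero Γ] (v : Valuation K Γ)
    (h : ∀ c : C, c ≠ 0 → v (algebraMap C K c) = 1) (x : K) (hx : v x < 1) (hx0 : x ≠ 0) :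
    Transcendental C x := by
  rw [transcendental_iff]
  intro p hp
  by_contra h0
  obtain ⟨m, hm⟩ := (aux_val_aeval v h x hx p).2.2 h0
  rw [hp, map_zero] at hm
  exact pow_ne_zero m ((Valuation.ne_zero_iff v).2 hx0) hm.symm

theorem aux_rel {E K Γ : Type*} [Field E] [Field K] [Algebra E K] [FiniteDimensional E K]
    [LinearOrderedCommGroupWithZero Γ] (v : Valuation K Γ) (a : K) (ha : a ≠ 0) :
    ∃ j : ℕ, 0 < j ∧ j ≤ Module.finrank E K ∧ ∃ e : E, e ≠ 0 ∧ v a ^ j = v (algebraMap E K e) := by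
  classical
  have hint : IsIntegral E a := Algebra.IsIntegral.isIntegral a
  set p := minpoly E a with hp
  have hp0 : p ≠ 0 := minpoly.ne_zero hint
  have hdeg : p.natDegree ≤ Module.finrank E K := minpoly.natDegree_le a
  have hsum : ∑ i ∈ p.support, algebraMap E K (p.coeff i) * a ^ i = 0 := by
    have := minpoly.aeval E a
    rw [Polynomial.aeval_def, Polynomial.eval₂_eq_sum, Polynomial.sum] at this
    exact this
  obtain ⟨i, hi, hmax⟩ := Finset.exists_max_image p.support
    (fun i => v (algebraMap E K (p.coeff i) * a ^ i)) (Polynomial.support_nonempty.2 hp0)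
  have hne : ∀ i ∈ p.support, algebraMap E K (p.coeff i) ≠ 0 := by
    intro i hi
    simpa using hi
  have key : ∃ j ∈ p.support, j ≠ i ∧
      v (algebraMap E K (p.coeff j) * a ^ j) = v (algebraMap E K (p.coeff i) * a ^ i) := by
    by_contra hcon
    push Not at hcon
    have := Valuation.map_sum_eq_of_lt v (f := fun i => algebraMap E K (p.coeff i) * a ^ i) hi
      (by
        intro j hj
        simp only [Finset.mem_sdiff, Finset.mem_singleton] at hj
        exact lt_of_le_of_ne (hmax j hj.1) (hcon j hj.1 hj.2))
    rw [hsum, map_zero] at this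
    exact (Valuation.ne_zero_iff v).2 (mul_ne_zero (hne i hi) (pow_ne_zero _ ha)) this.symm
  obtain ⟨j, hj, hji, hv⟩ := key
  have main : ∀ i ∈ p.support, ∀ j ∈ p.support, i < j →
      v (algebraMap E K (p.coeff j) * a ^ j) = v (algebraMap E K (p.coeff i) * a ^ i) →
      ∃ j : ℕ, 0 < j ∧ j ≤ Module.finrank E K ∧
        ∃ e : E, e ≠ 0 ∧ v a ^ j = v (algebraMap E K e) := by
    intro i hi j hj hij hv
    refine ⟨j - i, by omega, ?_, p.coeff i / p.coeff j,
      div_ne_zero (by simpa using hi) (by simpa using hj), ?_⟩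
    · have := Polynomial.le_natDegree_of_mem_supp j hj
      omega
    · have hva : v a ≠ 0 := (Valuation.ne_zero_iff v).2 ha
      have hvj : v (algebraMap E K (p.coeff j)) ≠ 0 := (Valuation.ne_zero_iff v).2 (hne j hj)
      rw [map_div₀, map_div₀, eq_div_iff hvj]
      have hj' : j = (j - i) + i := by omega
      rw [map_mul, map_mul, map_pow, map_pow] at hv
      apply mul_right_cancel₀ (pow_ne_zero i hva)
      rw [← hv]
      conv_rhs => rw [hj', pow_add]
      rw [← hj']
      ac_rfl
  rcases lt_or_gt_of_ne hji with h | h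
  · exact main j hj i hi h hv.symm
  · exact main i hi j hj h hv

theorem aux_cyclic {Γ : Type*} [LinearOrderedCommGroupWithZero Γ] (N : ℕ) (hN : 0 < N)
    (g : Γˣ) (hg : g ≠ 1) (h : ∀ a : Γˣ, ∃ n : ℤ, a ^ N = g ^ n) :
    Nonempty (Γˣ ≃* Multiplicative ℤ) := by
  have : Nontrivial Γˣ := ⟨g, 1, hg⟩
  let f : Γˣ →* Subgroup.zpowers g :=
    (powMonoidHom N).codRestrict (Subgroup.zpowers g) (by
      intro a
      obtain ⟨n, hn⟩ := h a
      exact ⟨n, hn.symm⟩)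
  have hf : Function.Injective f := by
    intro a b hab
    have : a ^ N = b ^ N := congrArg Subtype.val hab
    exact pow_left_injective hN.ne' this
  have hc : IsCyclic Γˣ := isCyclic_of_injective f hf
  obtain ⟨e⟩ := LinearOrderedCommGroup.isCyclic_iff_nonempty_equiv_int.1 hc
  exact ⟨e.toMulEquiv⟩

theorem aux_unit {K : Type*} [Field K] (O : ValuationSubring K) (a : O)
    (h : IsLocalRing.residue O a ≠ 0) : O.valuation (a : K) = 1 := by
  have h1 : ¬ O.valuation (a : K) < 1 := by
    rwa [← ValuationSubring.valuation_lt_one_iff, ← IsLocalRing.residue_eq_zero_iff]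
  exact le_antisymm (ValuationSubring.valuation_le_one O a) (not_lt.1 h1)

theorem aux_upper {k K : Type*} [Field k] [Field K] [Algebra k K] (O : ValuationSubring K)
    (h : ∀ c : k, algebraMap k K c ∈ O) (x : K) (hx : O.valuation x < 1) (hx0 : x ≠ 0) :
    letI := (resMap O h).toAlgebra
    Algebra.trdeg k (IsLocalRing.ResidueField O) + 1 ≤ Algebra.trdeg k K := by
  letI := (resMap O h).toAlgebra
  letI : Algebra k O := ((algebraMap k K).codRestrict O.toSubring h).toAlgebra
  let ι : O →ₐ[k] K := { O.subtype with commutes' := fun _ => rfl }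
  let π : O →ₐ[k] IsLocalRing.ResidueField O :=
    { IsLocalRing.residue O with commutes' := fun _ => rfl }
  have hι : Function.Injective ι := Subtype.val_injective
  have hπ : Function.Surjective π := IsLocalRing.residue_surjective
  obtain ⟨s, hs⟩ := exists_isTranscendenceBasis k (IsLocalRing.ResidueField O)
  let u : s → O := fun i => Function.surjInv hπ i
  have hu : π ∘ u = ((↑) : s → _) := funext fun i => Function.surjInv_eq hπ _
  have hu1 : AlgebraicIndependent k u := by
    apply AlgebraicIndependent.of_comp π
    rw [hu]; exact hs.1
  have hu2 : AlgebraicIndependent k (ι ∘ u) := hu1.map' hι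
  have hC : ∀ c : Algebra.adjoin k (Set.range (ι ∘ u)), c ≠ 0 →
      O.valuation (algebraMap _ K c) = 1 := by
    rintro ⟨c, hc⟩ hc0
    have hc0' : c ≠ 0 := fun h => hc0 (Subtype.ext h)
    rw [Algebra.adjoin_range_eq_range_aeval] at hc
    obtain ⟨p, rfl⟩ := hc
    have hp : p ≠ 0 := by rintro rfl; simp at hc0'
    have e : MvPolynomial.aeval (ι ∘ u) p = ι (MvPolynomial.aeval u p) :=
      (MvPolynomial.comp_aeval_apply (f := u) ι p).symm
    change O.valuation (MvPolynomial.aeval (ι ∘ u) p) = 1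
    rw [e]
    apply aux_unit
    change π (MvPolynomial.aeval u p) ≠ 0
    have e2 : π (MvPolynomial.aeval u p) = MvPolynomial.aeval (π ∘ u) p :=
      MvPolynomial.comp_aeval_apply (f := u) π p
    rw [e2, hu]
    intro h0
    exact hp ((algebraicIndependent_iff.1 hs.1) p h0)
  have hopt := AlgebraicIndependent.option_iff.2 ⟨hu2, aux_transc O.valuation hC x hx hx0⟩
  have := hopt.cardinalMk_le_trdeg
  rwa [Cardinal.mk_option, hs.cardinalMk_eq_trdeg] at this

theorem aux_lower {k K : Type*} [Field k] [Field K] [Algebra k K] (O : ValuationSubring K)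
    (h : ∀ c : k, algebraMap k K c ∈ O) (F : IntermediateField k K)
    (hF : ∀ c ∈ F, c ≠ 0 → O.valuation c = 1) (s : Set K) (hs : s ⊆ F)
    (hsi : AlgebraicIndependent k ((↑) : s → K)) :
    letI := (resMap O h).toAlgebra
    Cardinal.mk s ≤ Algebra.trdeg k (IsLocalRing.ResidueField O) := by
  letI := (resMap O h).toAlgebra
  letI : Algebra k O := ((algebraMap k K).codRestrict O.toSubring h).toAlgebra
  let ι : O →ₐ[k] K := { O.subtype with commutes' := fun _ => rfl }
  let π : O →ₐ[k] IsLocalRing.ResidueField O :=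
    { IsLocalRing.residue O with commutes' := fun _ => rfl }
  have hO : ∀ c ∈ F, c ∈ O := by
    intro c hc
    by_cases h0 : c = 0
    · rw [h0]; exact O.zero_mem
    · rw [← ValuationSubring.valuation_le_one_iff]; exact (hF c hc h0).le
  let w : s → O := fun i => ⟨i, hO _ (hs i.2)⟩
  have hw : AlgebraicIndependent k (π ∘ w) := by
    rw [algebraicIndependent_iff]
    intro p hp
    have e2 : π (MvPolynomial.aeval w p) = MvPolynomial.aeval (π ∘ w) p :=
      MvPolynomial.comp_aeval_apply (f := w) π p
    rw [← e2] at hp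
    have h1 : O.valuation ((MvPolynomial.aeval w p : O) : K) < 1 := by
      rw [← ValuationSubring.valuation_lt_one_iff, ← IsLocalRing.residue_eq_zero_iff]
      exact hp
    have e : MvPolynomial.aeval ((↑) : s → K) p = ι (MvPolynomial.aeval w p) :=
      (MvPolynomial.comp_aeval_apply (f := w) ι p).symm
    have hm : MvPolynomial.aeval ((↑) : s → K) p ∈ F := by
      have : MvPolynomial.aeval ((↑) : s → K) p ∈ Algebra.adjoin k s := by
        have h2 := Algebra.adjoin_range_eq_range_aeval k ((↑) : s → K)
        rw [Subtype.range_coe] at h2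
        rw [h2]; exact ⟨p, rfl⟩
      exact (Algebra.adjoin_le (S := F.toSubalgebra) hs) this
    apply algebraicIndependent_iff.1 hsi
    by_contra h0
    have := hF _ hm h0
    rw [e] at this
    exact h1.ne this
  exact hw.cardinalMk_le_trdeg

/-- If `x, y ∈ K` are algebraically independent over the algebraically
closed base field `k`, then there is a Zariski prime divisor `v` of `K|k` with `v(x) > 0`
(i.e. `v(x) < 1` and `v(x) ≠ 0` multiplicatively) and `v(y) = 0` (i.e. `v(y) = 1`). -/
theorem statement11 (k K : Type*) [Field k] [Field K] [Algebra k K] [IsAlgClosed k]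
    (hKfg : (⊤ : IntermediateField k K).FG)
    (x y : K) (hxy : AlgebraicIndependent k ![x, y]) :
    ∃ O : ValuationSubring K, IsZPD k O ∧
      O.valuation x < 1 ∧ O.valuation x ≠ 0 ∧ O.valuation y = 1 := by
  classical
  have hinj := hxy.injective
  have hxney : x ≠ y := by
    intro h
    have : (0 : Fin 2) = 1 := hinj (by simpa using h)
    exact absurd this (by decide)
  have hess : Algebra.EssFiniteType k K := IntermediateField.fg_top_iff.1 hKfg
  obtain ⟨S, hS, hSb⟩ := exists_isTranscendenceBasis_superset (R := k)
    (s := Set.range ![x, y]) (AlgebraicIndependent.coe_range hxy)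
  have hxS : x ∈ S := hS ⟨0, rfl⟩
  have hyS : y ∈ S := hS ⟨1, rfl⟩
  let S' : Set K := S \ {x}
  have hyS' : y ∈ S' := ⟨hyS, fun h => hxney h.symm⟩
  have hins : S = S' ∪ {x} := by
    ext z; by_cases hz : z = x <;> simp [S', hz, hxS]
  let F : IntermediateField k K := IntermediateField.adjoin k S'
  have hxtr0 : Transcendental (Algebra.adjoin k S') x := by
    have h1 := hSb.1.transcendental_adjoin (s := {i : S | (i : K) ≠ x}) (i := ⟨x, hxS⟩) (by simp)
    have h2 : ((↑) : S → K) '' {i : S | (i : K) ≠ x} = S' := by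
      ext z; simp [S', and_comm]
    rw [h2] at h1
    exact h1
  have hxtr : Transcendental F x := by
    intro hal
    apply hxtr0
    open scoped IntermediateField.algebraAdjoinAdjoin in
    exact (IsFractionRing.isAlgebraic_iff (Algebra.adjoin k S') F K).2 hal
  have hx0 : x ≠ 0 := by
    rintro rfl
    exact hxtr isAlgebraic_zero
  let A : Subalgebra F K := Algebra.adjoin F {x}
  let xA : A := ⟨x, Algebra.subset_adjoin rfl⟩
  have hI : (Ideal.span {xA} : Ideal A.toSubring) ≠ ⊤ := by
    intro htop
    rw [Ideal.span_singleton_eq_top] at htop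
    obtain ⟨b, hb⟩ := htop.exists_right_inv
    have hb' : x * (b : K) = 1 := congrArg Subtype.val hb
    obtain ⟨q, hq⟩ : ∃ q : Polynomial F, Polynomial.aeval x q = (b : K) := by
      have := b.2
      change (b : K) ∈ Algebra.adjoin F {x} at this
      rw [Algebra.adjoin_singleton_eq_range_aeval] at this
      exact this
    have h0 : Polynomial.X * q - 1 = 0 := by
      apply (transcendental_iff.1 hxtr)
      simp [hq, hb']
    have := congrArg (fun p => Polynomial.coeff p 0) h0
    simp at this
  obtain ⟨O, hAO, hspan⟩ := Ideal.image_subset_nonunits_valuationSubring (K := K) _ hI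
  have hvx : O.valuation x < 1 := by
    rw [← ValuationSubring.mem_nonunits_iff]
    exact hspan ⟨xA, Ideal.subset_span rfl, rfl⟩
  have hFO : ∀ c ∈ F, c ∈ O := fun c hc => hAO (A.algebraMap_mem ⟨c, hc⟩)
  have hF : ∀ c ∈ F, c ≠ 0 → O.valuation c = 1 := by
    intro c hc h0
    have h1 := (O.valuation_le_one_iff c).2 (hFO c hc)
    have h2 := (O.valuation_le_one_iff c⁻¹).2 (hFO _ (F.inv_mem hc))
    rw [map_inv₀] at h2
    have hp : 0 < O.valuation c := zero_lt_iff.2 ((Valuation.ne_zero_iff _).2 h0)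
    exact le_antisymm h1 ((inv_le_one₀ hp).1 h2)
  have hbase : ∀ c : k, algebraMap k K c ∈ O := fun c => hFO _ (F.algebraMap_mem c)
  have hvx0 : O.valuation x ≠ 0 := (Valuation.ne_zero_iff _).2 hx0
  have hS'F : S' ⊆ F := IntermediateField.subset_adjoin k S'
  have hy0 : y ≠ 0 := by
    rintro rfl
    exact hxy.ne_zero 1 rfl
  refine ⟨O, ⟨hbase, ?_, ?_, ?_⟩, hvx, hvx0, hF y (hS'F hyS') hy0⟩
  · rintro rfl
    have h1 : ((⊤ : ValuationSubring K).valuation x⁻¹) ≤ 1 :=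
      (ValuationSubring.valuation_le_one_iff _ _).2 trivial
    rw [map_inv₀, inv_le_one₀ (zero_lt_iff.2 hvx0)] at h1
    exact absurd hvx (not_lt.2 h1)
  · let E : IntermediateField k K := IntermediateField.adjoin k S
    have hEv : ∀ e ∈ E, e ≠ 0 → ∃ n : ℤ, O.valuation e = O.valuation x ^ n := by
      intro e he he0
      have he' : e ∈ IntermediateField.adjoin F {x} := by
        have h1 := IntermediateField.adjoin_adjoin_left k S' {x}
        rw [← hins] at h1
        have h2 : e ∈ IntermediateField.restrictScalars k (IntermediateField.adjoin F {x}) := by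
          rw [h1]; exact he
        exact h2
      obtain ⟨r, s, rfl⟩ := (IntermediateField.mem_adjoin_simple_iff F e).1 he'
      have hr : r ≠ 0 := by rintro rfl; simp at he0
      have hs : s ≠ 0 := by rintro rfl; simp at he0
      have hFc : ∀ c : F, c ≠ 0 → O.valuation (algebraMap F K c) = 1 := fun c hc =>
        hF c c.2 (fun h => hc (Subtype.ext h))
      obtain ⟨m, hm⟩ := (aux_val_aeval O.valuation hFc x hvx r).2.2 hr
      obtain ⟨n, hn⟩ := (aux_val_aeval O.valuation hFc x hvx s).2.2 hs
      refine ⟨(m : ℤ) - n, ?_⟩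
      rw [map_div₀, hm, hn, zpow_sub₀ hvx0, zpow_natCast, zpow_natCast]
    have halg : Algebra.IsAlgebraic E K := by
      have := hSb.isAlgebraic_field
      rw [Subtype.range_coe] at this
      exact this
    have hess' : Algebra.EssFiniteType E K := Algebra.EssFiniteType.of_comp k E K
    have hfin : FiniteDimensional E K := Algebra.finite_of_essFiniteType_of_isAlgebraic
    apply aux_cyclic (Nat.factorial (Module.finrank E K)) (Nat.factorial_pos _)
      (Units.mk0 _ hvx0)
    · intro h
      have := congrArg Units.val h
      simp at this
      exact hvx.ne this
    · intro g
      obtain ⟨a, ha⟩ := O.valuation_surjective (g : O.ValueGroup)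
      have ha0 : a ≠ 0 := by
        rintro rfl
        rw [map_zero] at ha
        exact g.ne_zero ha.symm
      obtain ⟨j, hj, hjd, e, he0, he⟩ := aux_rel (E := E) O.valuation a ha0
      obtain ⟨n, hn⟩ := hEv e e.2 (fun h => he0 (Subtype.ext h))
      obtain ⟨m, hm⟩ := Nat.dvd_factorial hj hjd
      refine ⟨n * m, ?_⟩
      apply Units.ext
      rw [hm, pow_mul, zpow_mul]
      push_cast
      rw [Units.val_mk0, ← ha, he, zpow_natCast]
      congr 1
  · apply le_antisymm
    · exact aux_upper O hbase x hvx hx0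
    · have h1 := aux_lower O hbase F hF S' hS'F
        (AlgebraicIndependent.mono (t := S') Set.sdiff_subset hSb.1)
      have h2 : Cardinal.mk S = Cardinal.mk S' + 1 := by
        have : S = insert x S' := by rw [hins, Set.union_singleton]
        rw [this]
        exact Cardinal.mk_insert (by simp [S'])
      have h3 := hSb.cardinalMk_eq_trdeg
      rw [h2] at h3
      change Algebra.trdeg k K ≤ _
      rw [← h3]
      exact add_le_add_left h1 1
end
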